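/- Let ρ_X be the standard normal density on ℝ^n, f : ℝ^n → [0,∞) continuously differentiable and nonnegative with ρ_X-square-integrable gradient, C = ∫ ∇f ∇fᵀ ρ_X dx = W Λ Wᵀ with eigenvalues λ₁ ≥ ⋯ ≥ λ_n ≥ 0, Ŵ = [Ŵ₁ Ŵ₂] orthogonal with ‖W − Ŵ‖ ≤ ε in spectral norm, f_ĝ(x) = ĝ(Ŵ₁ᵀx) with ĝ(ŷ) = ∫ f(Ŵ₁ŷ + Ŵ₂ẑ) φ_{n−k}(ẑ) dẑ. Define the posterior densities ρ_post(x) = e^{−f(x)} ρ_X(x)/Z with Z = ∫ e^{−f} ρ_X dx, and ρ_{post,ĝ}(x) = e^{−f_ĝ(x)} ρ_X(x)/Z_ĝ with Z_ĝ = ∫ e^{−f_ĝ} ρ_X dx. Then d_H(ρ_post, ρ_{post,ĝ}) ≤ L ( ε(λ₁ + ⋯ + λ_k)^{1/2} + (λ_{k+1} + ⋯ + λ_n)^{1/2} ), where L² = (1/8) ( Z · exp(−∫ f(x) ρ_X(x) dx) )^{−1/2}. -/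

import Mathlib

open MeasureTheory Matrix Set
open scoped Matrix.Norms.L2Operator

/-- The standard normal density on `ℝ^n`. -/
noncomputable def gaussDensity (n : ℕ) (x : Fin n → ℝ) : ℝ :=
  (2 * Real.pi) ^ (-(n : ℝ) / 2) * Real.exp (-(∑ i, x i ^ 2) / 2)

/-- The vector of partial derivatives (gradient) of `f : ℝ^n → ℝ`. -/
noncomputable def pgrad {n : ℕ} (f : (Fin n → ℝ) → ℝ) (x : Fin n → ℝ) : Fin n → ℝ :=
  fun i => fderiv ℝ f x (Pi.single i 1)

/-- The Hellinger distance between two densities on `ℝ^n`: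
`d_H(p,q) = ((1/2) ∫ (√p - √q)² dx)^{1/2}`. -/
noncomputable def hellingerDist {n : ℕ} (p q : (Fin n → ℝ) → ℝ) : ℝ :=
  Real.sqrt ((1 / 2) * ∫ x, (Real.sqrt (p x) - Real.sqrt (q x)) ^ 2)


noncomputable def gam (n : ℕ) : Measure (Fin n → ℝ) :=
  volume.withDensity (fun x => ENNReal.ofReal (gaussDensity n x))

lemma gaussDensity_cont (n : ℕ) : Continuous (gaussDensity n) := by
  unfold gaussDensity; fun_prop

lemma gaussDensity_pos (n : ℕ) (x) : 0 < gaussDensity n x := by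
  unfold gaussDensity; positivity

lemma gam_integral (n : ℕ) (h : (Fin n → ℝ) → ℝ) :
    ∫ x, h x ∂(gam n) = ∫ x, h x * gaussDensity n x := by
  unfold gam
  rw [integral_withDensity_eq_integral_toReal_smul]
  · congr 1; ext x
    rw [ENNReal.toReal_ofReal (gaussDensity_pos n x).le, smul_eq_mul, mul_comm]
  · exact ((gaussDensity_cont n).measurable).ennreal_ofReal
  · simp

lemma gam_integrable (n : ℕ) (h : (Fin n → ℝ) → ℝ) :
    Integrable h (gam n) ↔ Integrable (fun x => h x * gaussDensity n x) := by
  unfold gam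
  rw [integrable_withDensity_iff_integrable_smul']
  · apply iff_of_eq; congr 1; ext x
    rw [ENNReal.toReal_ofReal (gaussDensity_pos n x).le, smul_eq_mul, mul_comm]
  · exact ((gaussDensity_cont n).measurable).ennreal_ofReal
  · simp

lemma exp_sq_integrable (n : ℕ) (b : ℝ) (hb : 0 < b) :
    Integrable (fun x : Fin n → ℝ => Real.exp (-b * ∑ i, x i ^ 2)) := by
  have := Integrable.fintype_prod (f := fun (_ : Fin n) (t : ℝ) => Real.exp (-b * t ^ 2))
    (μ := fun _ => volume) (fun i => integrable_exp_neg_mul_sq hb)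
  refine Integrable.congr this (Filter.Eventually.of_forall fun x => ?_)
  simp only [Finset.mul_sum, Real.exp_sum]

lemma gaussDensity_eq (n : ℕ) (x : Fin n → ℝ) : gaussDensity n x =
    (2 * Real.pi) ^ (-(n : ℝ) / 2) * Real.exp (-(1/2) * ∑ i, x i ^ 2) := by
  unfold gaussDensity; congr 2; ring

lemma gaussDensity_integral (n : ℕ) : ∫ x, gaussDensity n x = 1 := by
  simp_rw [gaussDensity_eq, Finset.mul_sum, Real.exp_sum]
  rw [integral_const_mul,
    integral_fintype_prod_volume_eq_prod (fun (_ : Fin n) (t : ℝ) => Real.exp (-(1/2) * t ^ 2))]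
  simp_rw [integral_gaussian]
  simp only [Finset.prod_const, Finset.card_univ, Fintype.card_fin]
  have : Real.pi / (1/2) = 2 * Real.pi := by ring
  rw [this, Real.sqrt_eq_rpow, ← Real.rpow_natCast, ← Real.rpow_mul (by positivity),
    ← Real.rpow_add (by positivity)]
  rw [show -(n:ℝ)/2 + 1/2 * n = 0 by ring, Real.rpow_zero]

lemma gaussDensity_integrable (n : ℕ) : Integrable (gaussDensity n) := by
  have := (exp_sq_integrable n (1/2) (by norm_num)).const_mul ((2 * Real.pi) ^ (-(n : ℝ) / 2))
  refine this.congr (Filter.Eventually.of_forall fun x => ?_)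
  simp only [gaussDensity_eq]

instance gam_prob (n : ℕ) : IsProbabilityMeasure (gam n) := by
  constructor
  unfold gam
  rw [withDensity_apply _ MeasurableSet.univ, Measure.restrict_univ,
    ← ofReal_integral_eq_lintegral_ofReal (gaussDensity_integrable n)
      (Filter.Eventually.of_forall fun x => (gaussDensity_pos n x).le), gaussDensity_integral]
  simp

lemma sq_integrable (n : ℕ) (i : Fin n) : Integrable (fun x => x i ^ 2) (gam n) := by
  rw [gam_integrable]
  have := (exp_sq_integrable n (1/4) (by norm_num)).const_mul (4 * (2 * Real.pi) ^ (-(n : ℝ) / 2))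
  refine this.mono' ?_ (Filter.Eventually.of_forall fun x => ?_)
  · exact (Continuous.mul (by fun_prop) (gaussDensity_cont n)).aestronglyMeasurable
  · rw [Real.norm_of_nonneg (mul_nonneg (sq_nonneg _) (gaussDensity_pos n x).le), gaussDensity_eq]
    set S := ∑ i, x i ^ 2 with hS
    have h1 : x i ^ 2 ≤ S := Finset.single_le_sum (f := fun i => x i ^ 2)
      (fun j _ => sq_nonneg _) (Finset.mem_univ i)
    have h2 : x i ^ 2 ≤ 4 * Real.exp (1/4 * S) := by
      have := Real.add_one_le_exp (1/4 * S)
      linarith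
    have h3 : Real.exp (-(1/4) * S) = Real.exp (1/4 * S) * Real.exp (-(1/2) * S) := by
      rw [← Real.exp_add]; ring_nf
    rw [h3]
    have : 0 ≤ (2 * Real.pi) ^ (-(n : ℝ) / 2) * Real.exp (-(1/2) * S) := by positivity
    nlinarith

lemma mp_density {α β : Type*} [MeasurableSpace α] [MeasurableSpace β] {μ : Measure α}
    {ν : Measure β} {T : α → β} (hT : MeasurePreserving T μ ν) {p : α → ENNReal}
    {q : β → ENNReal} (hq : Measurable q) (hpq : ∀ x, q (T x) = p x) :
    MeasurePreserving T (μ.withDensity p) (ν.withDensity q) := by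
  refine ⟨hT.measurable, ?_⟩
  ext s hs
  rw [Measure.map_apply hT.measurable hs, withDensity_apply _ (hT.measurable hs),
    withDensity_apply _ hs, ← hT.setLIntegral_comp_preimage hs hq]
  simp_rw [hpq]

lemma gam_prod (k m : ℕ) : (gam k).prod (gam m) = (volume : Measure ((Fin k → ℝ) × (Fin m → ℝ))).withDensity
    (fun p => ENNReal.ofReal (gaussDensity k p.1) * ENNReal.ofReal (gaussDensity m p.2)) := by
  unfold gam
  rw [prod_withDensity]
  · rfl
  · exact ((gaussDensity_cont _).measurable).ennreal_ofReal
  · exact ((gaussDensity_cont _).measurable).ennreal_ofReal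

lemma orth_mp {ι : Type*} [Fintype ι] [DecidableEq ι] (R : Matrix ι ι ℝ) (hR : Rᵀ * R = 1) :
    MeasurePreserving (fun x : ι → ℝ => R *ᵥ x) volume volume := by
  have hd : |R.det| = 1 := by
    have := congrArg Matrix.det hR
    rw [Matrix.det_mul, Matrix.det_transpose, Matrix.det_one] at this
    have h2 : |R.det| * |R.det| = 1 := by rw [← abs_mul, this, abs_one]
    nlinarith [abs_nonneg R.det]
  have h0 : R.det ≠ 0 := by intro h; rw [h] at hd; simp at hd
  refine ⟨by fun_prop, ?_⟩
  have := Real.map_matrix_volume_pi_eq_smul_volume_pi h0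
  rw [abs_inv, hd] at this
  simp at this
  exact this

lemma orth_sq {ι : Type*} [Fintype ι] [DecidableEq ι] (R : Matrix ι ι ℝ) (hR : Rᵀ * R = 1)
    (x : ι → ℝ) : ∑ i, (R *ᵥ x) i ^ 2 = ∑ i, x i ^ 2 := by
  have : (R *ᵥ x) ⬝ᵥ (R *ᵥ x) = x ⬝ᵥ x := by
    rw [Matrix.dotProduct_mulVec, Matrix.vecMul_mulVec, ← Matrix.dotProduct_mulVec,  hR, Matrix.one_mulVec]
  simpa [dotProduct, sq] using this

lemma dens_prod (k m n : ℕ) (h : k + m = n) (x : Fin k → ℝ) (y : Fin m → ℝ) (w : Fin n → ℝ)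
    (hs : ∑ i, w i ^ 2 = ∑ i, x i ^ 2 + ∑ i, y i ^ 2) :
    gaussDensity n w = gaussDensity k x * gaussDensity m y := by
  subst h
  unfold gaussDensity
  rw [hs, mul_mul_mul_comm, ← Real.rpow_add (by positivity), ← Real.exp_add]
  congr 2
  · push_cast; ring
  · ring

lemma T_mp (k m : ℕ) (Wh : Matrix (Fin (k + m)) (Fin (k + m)) ℝ) (hWh : Whᵀ * Wh = 1) :
    MeasurePreserving (fun p : (Fin k → ℝ) × (Fin m → ℝ) =>
      Wh.submatrix id (Fin.castAdd m) *ᵥ p.1 + Wh.submatrix id (Fin.natAdd k) *ᵥ p.2)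
      ((gam k).prod (gam m)) (gam (k + m)) := by
  have e1 := volume_measurePreserving_sumPiEquivProdPi_symm (fun _ : Fin k ⊕ Fin m => ℝ)
  have e2 := volume_measurePreserving_piCongrLeft (fun _ : Fin (k + m) => ℝ) finSumFinEquiv
  have e3 := (orth_mp Wh hWh).comp (e2.comp e1)
  have key : ∀ p : (Fin k → ℝ) × (Fin m → ℝ),
     ((MeasurableEquiv.piCongrLeft (fun _ : Fin (k + m) => ℝ) finSumFinEquiv) 
       ((MeasurableEquiv.sumPiEquivProdPi (fun _ : Fin k ⊕ Fin m => ℝ)).symm p)) = Fin.append p.1 p.2 := by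
    intro p
    ext i
    refine Fin.addCases (fun j => ?_) (fun j => ?_) i
    · rw [Fin.append_left, ← finSumFinEquiv_apply_left, MeasurableEquiv.coe_piCongrLeft, Equiv.piCongrLeft_apply_apply]
      rfl
    · rw [Fin.append_right, ← finSumFinEquiv_apply_right, MeasurableEquiv.coe_piCongrLeft, Equiv.piCongrLeft_apply_apply]
      rfl
  have key2 : ∀ p : (Fin k → ℝ) × (Fin m → ℝ), Wh *ᵥ (Fin.append p.1 p.2) = 
     Wh.submatrix id (Fin.castAdd m) *ᵥ p.1 + Wh.submatrix id (Fin.natAdd k) *ᵥ p.2 := by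
    intro p; ext i
    simp [Matrix.mulVec, dotProduct, Fin.sum_univ_add]
  have e4 : MeasurePreserving (fun p : (Fin k → ℝ) × (Fin m → ℝ) =>
      Wh.submatrix id (Fin.castAdd m) *ᵥ p.1 + Wh.submatrix id (Fin.natAdd k) *ᵥ p.2) volume volume := by
    convert e3 using 1
    ext1 p
    rw [← key2, ← key]; rfl
  rw [gam_prod]
  unfold gam
  refine mp_density e4 ((gaussDensity_cont _).measurable).ennreal_ofReal fun p => ?_
  rw [← ENNReal.ofReal_mul (gaussDensity_pos _ _).le]
  congr 1
  apply dens_prod _ _ _ rfl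
  rw [← key2, orth_sq _ hWh, Fin.sum_univ_add]
  simp

noncomputable def rot (n : ℕ) (θ : ℝ) (p : (Fin n → ℝ) × (Fin n → ℝ)) : (Fin n → ℝ) × (Fin n → ℝ) :=
  (Real.cos θ • p.1 + Real.sin θ • p.2, (-Real.sin θ) • p.1 + Real.cos θ • p.2)

lemma rot_mp (n : ℕ) (θ : ℝ) : MeasurePreserving (rot n θ) ((gam n).prod (gam n)) ((gam n).prod (gam n)) := by
  let R : Matrix (Fin n ⊕ Fin n) (Fin n ⊕ Fin n) ℝ := Matrix.fromBlocks (Real.cos θ • 1) (Real.sin θ • 1)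
    ((-Real.sin θ) • 1) (Real.cos θ • 1)
  have hR : Rᵀ * R = 1 := by
    simp only [R, Matrix.fromBlocks_transpose, Matrix.fromBlocks_multiply, Matrix.transpose_smul, Matrix.transpose_one]
    simp only [Matrix.smul_mul, Matrix.one_mul, smul_smul, ← add_smul]
    rw [← Matrix.fromBlocks_one]
    have := Real.sin_sq_add_cos_sq θ
    congr 1
    · rw [show Real.cos θ * Real.cos θ + -Real.sin θ * -Real.sin θ = 1 by nlinarith, one_smul]
    · rw [show Real.cos θ * Real.sin θ + -Real.sin θ * Real.cos θ = 0 by ring, zero_smul]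
    · rw [show Real.sin θ * Real.cos θ + Real.cos θ * -Real.sin θ = 0 by ring, zero_smul]
    · rw [show Real.sin θ * Real.sin θ + Real.cos θ * Real.cos θ = 1 by nlinarith, one_smul]
  have e1 := volume_measurePreserving_sumPiEquivProdPi_symm (fun _ : Fin n ⊕ Fin n => ℝ)
  have e2 := volume_measurePreserving_sumPiEquivProdPi (fun _ : Fin n ⊕ Fin n => ℝ)
  have e3 := e2.comp ((orth_mp R hR).comp e1)
  have key : ∀ p : (Fin n → ℝ) × (Fin n → ℝ), R *ᵥ (Sum.elim p.1 p.2) = Sum.elim (rot n θ p).1 (rot n θ p).2 := by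
    intro p
    simp only [R, rot, Matrix.fromBlocks_mulVec, Matrix.smul_mulVec, Matrix.one_mulVec]
    rfl
  have e4 : MeasurePreserving (rot n θ) volume volume := by
    convert e3 using 1
    ext1 p
    have : (MeasurableEquiv.sumPiEquivProdPi (fun _ : Fin n ⊕ Fin n => ℝ)).symm p = Sum.elim p.1 p.2 := by
      ext i; cases i <;> rfl
    simp only [Function.comp, this, key]
    rfl
  rw [gam_prod]
  refine mp_density e4 ?_ fun p => ?_
  · have := (gaussDensity_cont n).measurable
    fun_prop
  · rw [← ENNReal.ofReal_mul (gaussDensity_pos _ _).le, ← ENNReal.ofReal_mul (gaussDensity_pos _ _).le]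
    congr 1
    have h := orth_sq R hR (Sum.elim p.1 p.2)
    rw [key] at h
    simp only [Fintype.sum_sum_type, Sum.elim_inl, Sum.elim_inr] at h
    have hw : ∀ q : (Fin n → ℝ) × (Fin n → ℝ), ∑ i, (Fin.append q.1 q.2) i ^ 2 = ∑ i, q.1 i ^ 2 + ∑ i, q.2 i ^ 2 := by
      intro q; rw [Fin.sum_univ_add]; simp only [Fin.append_left, Fin.append_right]
    rw [← dens_prod n n (n + n) rfl _ _ _ (hw (rot n θ p))]
    rw [← dens_prod n n (n + n) rfl p.1 p.2 (Fin.append (rot n θ p).1 (rot n θ p).2)]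
    rw [hw, h]

lemma fderiv_apply_sum {n : ℕ} (h : (Fin n → ℝ) → ℝ) (x v : Fin n → ℝ) :
    fderiv ℝ h x v = ∑ i, v i * pgrad h x i := by
  conv_lhs => rw [pi_eq_sum_univ' v]
  rw [map_sum]
  refine Finset.sum_congr rfl fun i _ => ?_
  rw [map_smul, smul_eq_mul]
  congr 2

lemma gaussDensity_hasFDeriv (n : ℕ) (x : Fin n → ℝ) (i : Fin n) :
    DifferentiableAt ℝ (gaussDensity n) x ∧
    fderiv ℝ (gaussDensity n) x (Pi.single i 1) = - (x i * gaussDensity n x) := by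
  have hd : DifferentiableAt ℝ (gaussDensity n) x := by unfold gaussDensity; fun_prop
  refine ⟨hd, ?_⟩
  have h1 := hd.hasFDerivAt.hasLineDerivAt (Pi.single i 1)
  have hs : HasDerivAt (fun t : ℝ => ∑ j, (x + t • (Pi.single i 1 : Fin n → ℝ)) j ^ 2)
      (∑ j, (2 * x j * (Pi.single i 1 : Fin n → ℝ) j)) 0 := by
    apply HasDerivAt.fun_sum
    intro j _
    have := (((hasDerivAt_id (0:ℝ)).mul_const ((Pi.single i 1 : Fin n → ℝ) j)).const_add (x j)).fun_pow 2
    simpa using this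
  have hs2 : (∑ j, (2 * x j * (Pi.single i 1 : Fin n → ℝ) j)) = 2 * x i := by
    simp [Pi.single_apply]
  rw [hs2] at hs
  have h2 : HasLineDerivAt ℝ (gaussDensity n) (- (x i * gaussDensity n x)) x (Pi.single i 1) := by
    unfold HasLineDerivAt gaussDensity
    have := ((hs.neg.div_const 2).exp).const_mul ((2 * Real.pi) ^ (-(n : ℝ) / 2))
    refine this.congr_deriv ?_
    simp only [Pi.neg_apply, zero_smul, add_zero]; ring
  exact h1.unique h2

lemma pgrad_cont {n : ℕ} {h : (Fin n → ℝ) → ℝ} (hh : ContDiff ℝ 1 h) (i : Fin n) :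
    Continuous (fun x => pgrad h x i) := by
  have := hh.continuous_fderiv one_ne_zero
  unfold pgrad
  fun_prop

/-- Gaussian integration by parts. -/
lemma gauss_ibp {n : ℕ} {h : (Fin n → ℝ) → ℝ} (hh : ContDiff ℝ 1 h) (M : ℝ)
    (hM : ∀ x, |h x| ≤ M) (i : Fin n) (hi : Integrable (fun x => pgrad h x i) (gam n)) :
    ∫ x, h x * x i ∂(gam n) = ∫ x, pgrad h x i ∂(gam n) := by
  have hx : Integrable (fun x : Fin n → ℝ => x i) (gam n) := by
    have : MemLp (fun x : Fin n → ℝ => x i) 2 (gam n) :=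
      (memLp_two_iff_integrable_sq (continuous_apply i).aestronglyMeasurable).2 (sq_integrable n i)
    exact this.integrable (by norm_num)
  have hhx : Integrable (fun x : Fin n → ℝ => h x * x i) (gam n) :=
    hx.bdd_mul hh.continuous.aestronglyMeasurable (Filter.Eventually.of_forall hM)
  have hh1 : Integrable h (gam n) :=
    Integrable.of_bound hh.continuous.aestronglyMeasurable M (Filter.Eventually.of_forall hM)
  have := integral_mul_fderiv_eq_neg_fderiv_mul_of_integrable (μ := volume) (f := h)
    (g := gaussDensity n) (v := Pi.single i 1) ((gam_integrable n _).1 hi) ?_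
    ((gam_integrable n _).1 hh1) (fun x _ => hh.differentiable one_ne_zero x)
    (fun x _ => (gaussDensity_hasFDeriv n x i).1)
  · rw [gam_integral, gam_integral]
    simp only [(gaussDensity_hasFDeriv n _ i).2] at this
    unfold pgrad
    rw [eq_comm, ← neg_inj, ← this, ← integral_neg]
    congr 1; ext x; ring
  · simp only [(gaussDensity_hasFDeriv n _ i).2]
    refine ((gam_integrable n _).1 hhx).neg.congr (Filter.Eventually.of_forall fun x => ?_)
    simp only [Pi.neg_apply]; ring

lemma pgrad_comp_affine {n : ℕ} {h : (Fin n → ℝ) → ℝ} (hh : ContDiff ℝ 1 h) (u : Fin n → ℝ)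
    (s : ℝ) (v : Fin n → ℝ) (i : Fin n) :
    pgrad (fun v => h (u + s • v)) v i = s * pgrad h (u + s • v) i := by
  unfold pgrad
  have h1 : HasFDerivAt (fun v : Fin n → ℝ => u + s • v) (s • ContinuousLinearMap.id ℝ (Fin n → ℝ)) v :=
    ((hasFDerivAt_id v).const_smul s).const_add u
  have h2 := ((hh.differentiable one_ne_zero (u + s • v)).hasFDerivAt).comp v h1
  have h3 := h2.fderiv
  rw [show (fun v => h (u + s • v)) = h ∘ (fun v => u + s • v) from rfl, h3]
  simp

lemma rot_cont (n : ℕ) : Continuous (fun q : ℝ × ((Fin n → ℝ) × (Fin n → ℝ)) => rot n q.1 q.2) := by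
  unfold rot; fun_prop

lemma rot_neg_rot (n : ℕ) (θ : ℝ) (p) : rot n (-θ) (rot n θ p) = p := by
  have := Real.sin_sq_add_cos_sq θ
  unfold rot
  ext i
  · simp; linear_combination (p.1 i) * this
  · simp; linear_combination (p.2 i) * this
  
lemma rot_integral (n : ℕ) (θ : ℝ) (F : (Fin n → ℝ) × (Fin n → ℝ) → ℝ) (hF : Continuous F) :
    ∫ p, F (rot n θ p) ∂((gam n).prod (gam n)) = ∫ p, F p ∂((gam n).prod (gam n)) := by
  conv_rhs => rw [← (rot_mp n θ).map_eq]
  rw [integral_map (rot_mp n θ).aemeasurable hF.aestronglyMeasurable]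

/-- inner estimate at a fixed angle -/
lemma inner_est {n : ℕ} {h : (Fin n → ℝ) → ℝ} (hh : ContDiff ℝ 1 h) (M : ℝ)
    (hM : ∀ x, |h x| ≤ M) (hi : ∀ i, Integrable (fun x => pgrad h x i ^ 2) (gam n)) (θ : ℝ)
    (hs : 0 ≤ Real.sin θ) :
    - ∫ p, h p.1 * fderiv ℝ h (rot n θ p).1 (rot n θ p).2 ∂((gam n).prod (gam n)) ≤
      Real.sin θ * ∫ x, ∑ i, pgrad h x i ^ 2 ∂(gam n) := by
  have hc := fun i => pgrad_cont hh i
  have hch := hh.continuous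
  have hcd := hh.continuous_fderiv one_ne_zero
  have hrc : Continuous (rot n (-θ)) := by unfold rot; fun_prop
  have hL2 : ∀ i, MemLp (fun x => pgrad h x i) 2 (gam n) := fun i =>
    (memLp_two_iff_integrable_sq (hc i).aestronglyMeasurable).2 (hi i)
  have hX2 : ∀ i, MemLp (fun x : Fin n → ℝ => x i) 2 (gam n) := fun i =>
      (memLp_two_iff_integrable_sq (continuous_apply i).aestronglyMeasurable).2 (sq_integrable n i)
  -- the L2 functions on the product
  have hA : ∀ i, MemLp (fun p : (Fin n → ℝ) × (Fin n → ℝ) => pgrad h p.1 i) 2 ((gam n).prod (gam n)) :=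
    fun i => MemLp.comp_measurePreserving (g := fun x => pgrad h x i) (hL2 i) measurePreserving_fst
  have hB : ∀ i, MemLp (fun p : (Fin n → ℝ) × (Fin n → ℝ) => pgrad h (rot n (-θ) p).1 i) 2
      ((gam n).prod (gam n)) :=
    fun i => MemLp.comp_measurePreserving (g := fun p : (Fin n → ℝ) × (Fin n → ℝ) => pgrad h p.1 i) (hA i) (rot_mp n (-θ))
  have hV : ∀ i, MemLp (fun p : (Fin n → ℝ) × (Fin n → ℝ) => p.2 i) 2 ((gam n).prod (gam n)) :=
    fun i => MemLp.comp_measurePreserving (g := fun x : Fin n → ℝ => x i) (hX2 i) measurePreserving_snd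
  have hAV : ∀ i, Integrable (fun p : (Fin n → ℝ) × (Fin n → ℝ) =>
      h (rot n (-θ) p).1 * (p.2 i * pgrad h p.1 i)) ((gam n).prod (gam n)) := fun i =>
    ((hV i).integrable_mul (hA i)).bdd_mul (c := M) (by
      exact Continuous.aestronglyMeasurable (by fun_prop)) (Filter.Eventually.of_forall fun p => hM _)
  have hAB : ∀ i, Integrable (fun p : (Fin n → ℝ) × (Fin n → ℝ) =>
      pgrad h p.1 i * pgrad h (rot n (-θ) p).1 i) ((gam n).prod (gam n)) := fun i =>
    (hA i).integrable_mul (hB i)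
  have step1 : ∫ p, h p.1 * fderiv ℝ h (rot n θ p).1 (rot n θ p).2 ∂((gam n).prod (gam n)) =
      ∑ i, ∫ p, h (rot n (-θ) p).1 * (p.2 i * pgrad h p.1 i) ∂((gam n).prod (gam n)) := by
    rw [← integral_finsetSum _ (fun i _ => hAV i)]
    rw [← rot_integral n θ (fun p => ∑ i, h (rot n (-θ) p).1 * (p.2 i * pgrad h p.1 i))]
    · congr 1; ext p
      rw [rot_neg_rot, fderiv_apply_sum, Finset.mul_sum]
    · fun_prop
  have step2 : ∀ i, ∫ p, h (rot n (-θ) p).1 * (p.2 i * pgrad h p.1 i) ∂((gam n).prod (gam n)) =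
      - Real.sin θ * ∫ p, pgrad h p.1 i * pgrad h (rot n (-θ) p).1 i ∂((gam n).prod (gam n)) := by
    intro i
    rw [← integral_const_mul, integral_prod _ (hAV i), integral_prod _ ((hAB i).const_mul _)]
    have hBi := ((hB i).integrable (by norm_num)).prod_right_ae
    apply integral_congr_ae
    filter_upwards [hBi] with u hu
    have e1 : ∀ v, (rot n (-θ) (u, v)).1 = Real.cos θ • u + (-Real.sin θ) • v := by
      intro v; simp [rot]
    simp only [e1] at hu ⊢
    have ibp := gauss_ibp (h := fun v => h (Real.cos θ • u + (-Real.sin θ) • v)) (n := n)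
      (hh.comp (by fun_prop)) M (fun v => hM _) i ?_
    · simp only [pgrad_comp_affine hh] at ibp
      calc _ = ∫ v, (h (Real.cos θ • u + (-Real.sin θ) • v) * v i) * pgrad h u i ∂(gam n) := by
            congr 1; ext v; ring
        _ = _ := by
            rw [integral_mul_const, ibp, ← integral_mul_const]
            congr 1; ext v; ring
    · simp only [pgrad_comp_affine hh]
      exact hu.const_mul _
  have step3 : ∀ i, ∫ p, pgrad h p.1 i * pgrad h (rot n (-θ) p).1 i ∂((gam n).prod (gam n)) ≤
      ∫ x, pgrad h x i ^ 2 ∂(gam n) := by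
    intro i
    have hA2 := (memLp_two_iff_integrable_sq (hA i).1).1 (hA i)
    have hB2 := (memLp_two_iff_integrable_sq (hB i).1).1 (hB i)
    have iA : ∫ p : (Fin n → ℝ) × (Fin n → ℝ), pgrad h p.1 i ^ 2 ∂((gam n).prod (gam n)) =
        ∫ x, pgrad h x i ^ 2 ∂(gam n) := by
      rw [integral_prod _ hA2]; simp
    have iB : ∫ p : (Fin n → ℝ) × (Fin n → ℝ), pgrad h (rot n (-θ) p).1 i ^ 2 ∂((gam n).prod (gam n)) =
        ∫ x, pgrad h x i ^ 2 ∂(gam n) := by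
      rw [← iA]
      exact rot_integral n (-θ) (fun p => pgrad h p.1 i ^ 2) (by have := hc i; fun_prop)
    calc _ ≤ ∫ p : (Fin n → ℝ) × (Fin n → ℝ), (1/2) * (pgrad h p.1 i ^ 2 + pgrad h (rot n (-θ) p).1 i ^ 2) ∂((gam n).prod (gam n)) := by
          apply integral_mono (hAB i) ((hA2.add hB2).const_mul _)
          intro p
          simp only [Pi.add_apply]
          nlinarith [sq_nonneg (pgrad h p.1 i - pgrad h (rot n (-θ) p).1 i)]
      _ = _ := by
          rw [integral_const_mul, integral_add hA2 hB2, iA, iB]; ring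
  rw [step1, integral_finsetSum _ (fun i _ => hi i), ← Finset.sum_neg_distrib, Finset.mul_sum]
  apply Finset.sum_le_sum
  intro i _
  rw [step2 i]
  have := step3 i
  nlinarith [mul_le_mul_of_nonneg_left this hs]

lemma rot_path {n : ℕ} {h : (Fin n → ℝ) → ℝ} (hh : ContDiff ℝ 1 h)
    (p : (Fin n → ℝ) × (Fin n → ℝ)) :
    ∫ θ in (0:ℝ)..(Real.pi / 2), fderiv ℝ h (rot n θ p).1 (rot n θ p).2 = h p.2 - h p.1 := by
  have hcd := hh.continuous_fderiv one_ne_zero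
  have hd : ∀ θ : ℝ, HasDerivAt (fun θ => h (rot n θ p).1)
      (fderiv ℝ h (rot n θ p).1 (rot n θ p).2) θ := by
    intro θ
    have h1 : HasDerivAt (fun θ => (rot n θ p).1) ((rot n θ p).2) θ := by
      unfold rot
      exact ((Real.hasDerivAt_cos θ).smul_const p.1).add ((Real.hasDerivAt_sin θ).smul_const p.2)
    exact ((hh.differentiable one_ne_zero _).hasFDerivAt).comp_hasDerivAt θ h1
  rw [intervalIntegral.integral_eq_sub_of_hasDerivAt (fun θ _ => hd θ)]
  · simp [rot]
  · apply Continuous.intervalIntegrable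
    unfold rot
    fun_prop

lemma poincare_bdd {n : ℕ} {h : (Fin n → ℝ) → ℝ} (hh : ContDiff ℝ 1 h) (M : ℝ)
    (hM : ∀ x, |h x| ≤ M) (hi : ∀ i, Integrable (fun x => pgrad h x i ^ 2) (gam n)) :
    ∫ x, (h x - ∫ y, h y ∂(gam n)) ^ 2 ∂(gam n) ≤ ∫ x, ∑ i, pgrad h x i ^ 2 ∂(gam n) := by
  have hc := fun i => pgrad_cont hh i
  have hch := hh.continuous
  have hcd := hh.continuous_fderiv one_ne_zero
  have hrc := rot_cont n
  have hM0 : 0 ≤ M := (abs_nonneg _).trans (hM 0)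
  have hh1 : Integrable h (gam n) :=
    Integrable.of_bound hch.aestronglyMeasurable M (Filter.Eventually.of_forall hM)
  have hh2 : Integrable (fun x => h x ^ 2) (gam n) := by
    refine Integrable.of_bound (by exact Continuous.aestronglyMeasurable (by fun_prop)) (M ^ 2) (Filter.Eventually.of_forall fun x => ?_)
    rw [norm_pow]
    exact pow_le_pow_left₀ (abs_nonneg _) (hM x) 2
  set P := (gam n).prod (gam n) with hP
  let H : ℝ → (Fin n → ℝ) × (Fin n → ℝ) → ℝ :=
    fun θ p => h p.1 * fderiv ℝ h (rot n θ p).1 (rot n θ p).2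
  have hHc : Continuous (Function.uncurry H) := by
    unfold Function.uncurry
    simp only [H]
    fun_prop
  let Q : (Fin n → ℝ) × (Fin n → ℝ) → ℝ := fun p => M * ∑ i, (p.2 i ^ 2 + pgrad h p.1 i ^ 2)
  have hQc : Continuous Q := by simp only [Q]; fun_prop
  have hQi : Integrable Q P := by
    apply Integrable.const_mul
    apply integrable_finsetSum
    intro i _
    exact ((sq_integrable n i).comp_snd (gam n)).add ((hi i).comp_fst (gam n))
  have hHQ : ∀ θ p, ‖H θ p‖ ≤ Q (rot n θ p) := by
    intro θ p
    simp only [H, Q, norm_mul]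
    refine mul_le_mul (hM _) ?_ (norm_nonneg _) hM0
    rw [fderiv_apply_sum]
    refine (norm_sum_le _ _).trans (Finset.sum_le_sum fun i _ => ?_)
    rw [norm_mul, Real.norm_eq_abs, Real.norm_eq_abs]
    rw [← sq_abs ((rot n θ p).2 i), ← sq_abs (pgrad h (rot n θ p).1 i)]
    nlinarith [sq_nonneg (|(rot n θ p).2 i| - |pgrad h (rot n θ p).1 i|), sq_nonneg (|(rot n θ p).2 i|), sq_nonneg (|pgrad h (rot n θ p).1 i|)]
  have hQr : ∀ θ, Integrable (fun p => Q (rot n θ p)) P := fun θ =>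
    (rot_mp n θ).integrable_comp_of_integrable hQi
  have hHθ : ∀ θ, Integrable (H θ) P := fun θ =>
    (hQr θ).mono' (hHc.comp (Continuous.prodMk_right θ)).aestronglyMeasurable
      (Filter.Eventually.of_forall (hHQ θ))
  have hHint : Integrable (Function.uncurry H)
      ((volume.restrict (Set.uIoc (0:ℝ) (Real.pi/2))).prod P) := by
    have hsm : AEStronglyMeasurable (Function.uncurry H)
      ((volume.restrict (Set.uIoc (0:ℝ) (Real.pi/2))).prod P) := hHc.aestronglyMeasurable
    rw [integrable_prod_iff hsm]
    refine ⟨Filter.Eventually.of_forall hHθ, ?_⟩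
    have : IsFiniteMeasure (volume.restrict (Set.uIoc (0:ℝ) (Real.pi/2))) := by
      constructor
      simp [Set.uIoc]
    refine Integrable.of_bound hsm.norm.integral_prod_right' (∫ p, Q p ∂P)
      (Filter.Eventually.of_forall fun θ => ?_)
    rw [Real.norm_of_nonneg (integral_nonneg fun p => norm_nonneg _), ← rot_integral n θ Q hQc]
    exact integral_mono (hHθ θ).norm (hQr θ) (hHQ θ)
  have hsw : ∫ θ in (0:ℝ)..(Real.pi/2), ∫ p, H θ p ∂P = ∫ p, (∫ θ in (0:ℝ)..(Real.pi/2), H θ p) ∂P :=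
    intervalIntegral_integral_swap hHint
  have hrhs : ∫ p, (∫ θ in (0:ℝ)..(Real.pi/2), H θ p) ∂P = (∫ x, h x ∂(gam n)) ^ 2 - ∫ x, h x ^ 2 ∂(gam n) := by
    have : ∀ p, (∫ θ in (0:ℝ)..(Real.pi/2), H θ p) = h p.1 * h p.2 - h p.1 ^ 2 := by
      intro p
      simp only [H]
      rw [intervalIntegral.integral_const_mul, rot_path hh]; ring
    simp_rw [this]
    rw [integral_sub (hh1.mul_prod hh1) (hh2.comp_fst _), integral_prod_mul, integral_fun_fst (fun x => h x ^ 2)]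
    simp; ring
  have hvar : ∫ x, (h x - ∫ y, h y ∂(gam n)) ^ 2 ∂(gam n) = ∫ x, h x ^ 2 ∂(gam n) - (∫ x, h x ∂(gam n)) ^ 2 := by
    set c := ∫ y, h y ∂(gam n) with hcdef
    have : ∀ x, (h x - c) ^ 2 = h x ^ 2 - ((2 * c) * h x - c ^ 2) := fun x => by ring
    simp_rw [this]
    have hi3 : Integrable (fun x => (2 * c) * h x - c ^ 2) (gam n) :=
      (hh1.const_mul _).sub (integrable_const _)
    rw [integral_sub hh2 hi3, integral_sub (hh1.const_mul _) (integrable_const _), integral_const_mul, ← hcdef]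
    simp; ring
  rw [hvar]
  set G := ∫ x, ∑ i, pgrad h x i ^ 2 ∂(gam n) with hG
  have hfin : ∫ θ in (0:ℝ)..(Real.pi/2), (-∫ p, H θ p ∂P) ≤ ∫ θ in (0:ℝ)..(Real.pi/2), Real.sin θ * G := by
    apply intervalIntegral.integral_mono_on (by positivity)
    · apply IntervalIntegrable.neg
      rw [intervalIntegrable_iff]
      exact hHint.integral_prod_left
    · exact Continuous.intervalIntegrable (by fun_prop) _ _
    · intro θ hθ
      exact inner_est hh M hM hi θ (Real.sin_nonneg_of_nonneg_of_le_pi hθ.1 (by linarith [hθ.2, Real.pi_pos]))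
  rw [intervalIntegral.integral_neg, hsw, hrhs, intervalIntegral.integral_mul_const, integral_sin] at hfin
  simp at hfin
  linarith

lemma poincare {n : ℕ} {h : (Fin n → ℝ) → ℝ} (hh : ContDiff ℝ 1 h) (hh1 : Integrable h (gam n)) :
    ∫⁻ x, ENNReal.ofReal ((h x - ∫ y, h y ∂(gam n)) ^ 2) ∂(gam n) ≤
      ∫⁻ x, ENNReal.ofReal (∑ i, pgrad h x i ^ 2) ∂(gam n) := by
  have hc := fun i => pgrad_cont hh i
  have hch := hh.continuous
  by_cases hfin : ∫⁻ x, ENNReal.ofReal (∑ i, pgrad h x i ^ 2) ∂(gam n) = ⊤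
  · rw [hfin]; exact le_top
  have hSi : Integrable (fun x => ∑ i, pgrad h x i ^ 2) (gam n) := by
    refine ⟨Continuous.aestronglyMeasurable (by fun_prop), ?_⟩
    rw [hasFiniteIntegral_iff_ofReal (Filter.Eventually.of_forall fun x => by positivity)]
    exact lt_top_iff_ne_top.2 hfin
  let t : ℕ → (Fin n → ℝ) → ℝ := fun N x => (N + 1 : ℝ) * Real.sin (h x / (N + 1))
  have htd : ∀ N, ContDiff ℝ 1 (t N) := fun N => by
    simp only [t]
    exact contDiff_const.mul (Real.contDiff_sin.comp (hh.div_const _))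
  have htg : ∀ N x i, pgrad (t N) x i ^ 2 ≤ pgrad h x i ^ 2 := by
    intro N x i
    have hN : (N + 1 : ℝ) ≠ 0 := by positivity
    have h1 : HasFDerivAt h (fderiv ℝ h x) x := (hh.differentiable one_ne_zero x).hasFDerivAt
    have h2 : HasFDerivAt (t N) _ x := ((h1.mul_const ((N + 1 : ℝ)⁻¹)).sin).const_mul (N + 1 : ℝ)
    have h3 : pgrad (t N) x i = Real.cos (h x * (N + 1 : ℝ)⁻¹) * pgrad h x i := by
      unfold pgrad
      rw [h2.fderiv]
      simp
      field_simp
    rw [h3, mul_pow]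
    exact mul_le_of_le_one_left (sq_nonneg _) (Real.cos_sq_le_one _)
  have htle : ∀ N x, |t N x| ≤ |h x| := by
    intro N x
    have hN : (0:ℝ) < N + 1 := by positivity
    simp only [t]
    rw [abs_mul, abs_of_pos hN]
    have : |Real.sin (h x / (N + 1))| ≤ |h x / (N + 1)| := Real.abs_sin_le_abs
    rw [abs_div, abs_of_pos hN, le_div_iff₀ hN] at this
    linarith
  have htlim : ∀ x, Filter.Tendsto (fun N => t N x) Filter.atTop (nhds (h x)) := by
    intro x
    have e : ∀ N : ℕ, t N x = h x * Real.sinc (h x / (N + 1)) := by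
      intro N
      have hN : (N + 1 : ℝ) ≠ 0 := by positivity
      simp only [t]
      by_cases h0 : h x = 0
      · simp [h0]
      · rw [Real.sinc_of_ne_zero (div_ne_zero h0 hN)]
        field_simp
    simp_rw [e]
    have l1 : Filter.Tendsto (fun N : ℕ => h x / ((N : ℝ) + 1)) Filter.atTop (nhds 0) := by
      have := (tendsto_one_div_add_atTop_nhds_zero_nat (𝕜 := ℝ)).const_mul (h x)
      simpa [div_eq_mul_inv] using this
    have l2 := ((Real.continuous_sinc.tendsto 0).comp l1).const_mul (h x)
    simpa using l2
  have htM : ∀ N x, |t N x| ≤ N + 1 := by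
    intro N x
    have hN : (0:ℝ) < N + 1 := by positivity
    simp only [t]
    rw [abs_mul, abs_of_pos hN]
    exact mul_le_of_le_one_right hN.le (Real.abs_sin_le_one _)
  have hEt : Filter.Tendsto (fun N => ∫ y, t N y ∂(gam n)) Filter.atTop (nhds (∫ y, h y ∂(gam n))) := by
    refine tendsto_integral_of_dominated_convergence (fun x => |h x|) (fun N => (htd N).continuous.aestronglyMeasurable) hh1.abs (fun N => Filter.Eventually.of_forall (htle N)) (Filter.Eventually.of_forall htlim)
  have hb : ∀ N, ∫⁻ x, ENNReal.ofReal ((t N x - ∫ y, t N y ∂(gam n)) ^ 2) ∂(gam n) ≤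
      ∫⁻ x, ENNReal.ofReal (∑ i, pgrad h x i ^ 2) ∂(gam n) := by
    intro N
    have hci := fun i => pgrad_cont (htd N) i
    have hct := (htd N).continuous
    have hii : ∀ i, Integrable (fun x => pgrad (t N) x i ^ 2) (gam n) := by
      intro i
      refine hSi.mono' (Continuous.aestronglyMeasurable (by have := hci i; fun_prop)) (Filter.Eventually.of_forall fun x => ?_)
      rw [Real.norm_of_nonneg (sq_nonneg _)]
      exact (htg N x i).trans (Finset.single_le_sum (f := fun i => pgrad h x i ^ 2) (fun j _ => sq_nonneg _) (Finset.mem_univ i))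
    have hp := poincare_bdd (htd N) (N + 1) (htM N) hii
    have hvint : Integrable (fun x => (t N x - ∫ y, t N y ∂(gam n)) ^ 2) (gam n) := by
      have : MemLp (t N) 2 (gam n) := MemLp.of_bound hct.aestronglyMeasurable (N+1) (Filter.Eventually.of_forall (htM N))
      exact (this.sub (memLp_const _)).integrable_sq
    rw [← ofReal_integral_eq_lintegral_ofReal hvint (Filter.Eventually.of_forall fun x => sq_nonneg _),
      ← ofReal_integral_eq_lintegral_ofReal hSi (Filter.Eventually.of_forall fun x => by positivity)]
    apply ENNReal.ofReal_le_ofReal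
    refine hp.trans (integral_mono (integrable_finsetSum _ fun i _ => hii i) hSi fun x => ?_)
    exact Finset.sum_le_sum fun i _ => htg N x i
  have hlim : ∀ x, Filter.Tendsto (fun N => ENNReal.ofReal ((t N x - ∫ y, t N y ∂(gam n)) ^ 2)) Filter.atTop
      (nhds (ENNReal.ofReal ((h x - ∫ y, h y ∂(gam n)) ^ 2))) := fun x =>
    (ENNReal.continuous_ofReal.tendsto _).comp (((htlim x).sub hEt).pow 2)
  calc _ = ∫⁻ x, Filter.liminf (fun N => ENNReal.ofReal ((t N x - ∫ y, t N y ∂(gam n)) ^ 2)) Filter.atTop ∂(gam n) := by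
        congr 1; ext x; exact (hlim x).liminf_eq.symm
    _ ≤ Filter.liminf (fun N => ∫⁻ x, ENNReal.ofReal ((t N x - ∫ y, t N y ∂(gam n)) ^ 2) ∂(gam n)) Filter.atTop := by
        apply lintegral_liminf_le
        intro N
        have hct := (htd N).continuous
        exact ENNReal.measurable_ofReal.comp (Continuous.measurable (by fun_prop))
    _ ≤ _ := by
        refine Filter.liminf_le_of_frequently_le' (Filter.Frequently.of_forall hb)

lemma col_le {N : ℕ} (A : Matrix (Fin N) (Fin N) ℝ) (j : Fin N) : ∑ a, A a j ^ 2 ≤ ‖A‖ ^ 2 := by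
  have := Matrix.l2_opNorm_mulVec A (WithLp.toLp 2 (Pi.single j 1))
  have h2 := pow_le_pow_left₀ (norm_nonneg _) this 2
  rw [EuclideanSpace.norm_sq_eq] at h2
  simpa [Matrix.mulVec, dotProduct, Pi.single_apply] using h2

lemma row_sq {N : ℕ} (A : Matrix (Fin N) (Fin N) ℝ) (j : Fin N) : ∑ i, A j i ^ 2 = (A * Aᵀ) j j := by
  simp [Matrix.mul_apply, sq]

lemma trace_bound (k m : ℕ) (W Wh C : Matrix (Fin (k + m)) (Fin (k + m)) ℝ)
    (hW : Wᵀ * W = 1) (hWh : Whᵀ * Wh = 1) (Λ : Fin (k + m) → ℝ) (hΛnonneg : ∀ i, 0 ≤ Λ i)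
    (hC : C = W * Matrix.diagonal Λ * Wᵀ) (ε : ℝ) (hε : 0 < ε) (hpert : ‖W - Wh‖ ≤ ε) :
    ∑ i : Fin m, ∑ a, ∑ b, Wh a (Fin.natAdd k i) * Wh b (Fin.natAdd k i) * C a b ≤
      (ε * Real.sqrt (∑ j : Fin k, Λ (Fin.castAdd m j)) +
        Real.sqrt (∑ j : Fin m, Λ (Fin.natAdd k j))) ^ 2 := by
  have hWh' : Wh * Whᵀ = 1 := mul_eq_one_comm.1 hWh
  set B := Wᵀ * Wh with hB
  have h1 : ∀ i : Fin (k + m), ∑ a, ∑ b, Wh a i * Wh b i * C a b = ∑ j, Λ j * B j i ^ 2 := by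
    intro i
    have e : Whᵀ * C * Wh = Bᵀ * Matrix.diagonal Λ * B := by
      rw [hC, hB, Matrix.transpose_mul, Matrix.transpose_transpose]
      simp only [Matrix.mul_assoc]
    have e2 := congrFun (congrFun e i) i
    have e3 : (Whᵀ * C * Wh) i i = ∑ a, ∑ b, Wh a i * Wh b i * C a b := by
      rw [Matrix.mul_apply, Finset.sum_comm]
      refine Finset.sum_congr rfl fun b _ => ?_
      rw [Matrix.mul_apply, Finset.sum_mul]
      refine Finset.sum_congr rfl fun a _ => ?_
      rw [Matrix.transpose_apply]; ring
    have e4 : (Bᵀ * Matrix.diagonal Λ * B) i i = ∑ j, Λ j * B j i ^ 2 := by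
      rw [Matrix.mul_apply]
      refine Finset.sum_congr rfl fun b _ => ?_
      rw [Matrix.mul_diagonal, Matrix.transpose_apply]; ring
    rw [← e3, e2, e4]
  have h2 : ∀ j : Fin m, ∑ i : Fin m, B (Fin.natAdd k j) (Fin.natAdd k i) ^ 2 ≤ 1 := by
    intro j
    have e := row_sq B (Fin.natAdd k j)
    have e2 : B * Bᵀ = 1 := by
      rw [hB, Matrix.transpose_mul, Matrix.transpose_transpose, Matrix.mul_assoc, ← Matrix.mul_assoc Wh, hWh', Matrix.one_mul, hW]
    rw [e2, Matrix.one_apply_eq, Fin.sum_univ_add] at e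
    have : 0 ≤ ∑ i : Fin k, B (Fin.natAdd k j) (Fin.castAdd m i) ^ 2 := Finset.sum_nonneg fun _ _ => sq_nonneg _
    linarith
  have h3 : ∀ j : Fin k, ∑ i : Fin m, B (Fin.castAdd m j) (Fin.natAdd k i) ^ 2 ≤ ε ^ 2 := by
    intro j
    set D := (W - Wh)ᵀ * Wh with hD
    have hDB : D = B - 1 := by rw [hD, Matrix.transpose_sub, Matrix.sub_mul, hWh]
    have e := row_sq D (Fin.castAdd m j)
    have e2 : D * Dᵀ = (W - Wh)ᵀ * (W - Wh)ᵀᵀ := by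
      rw [hD, Matrix.transpose_mul, Matrix.transpose_transpose, Matrix.mul_assoc, ← Matrix.mul_assoc Wh, hWh', Matrix.one_mul]
    rw [e2, ← row_sq, Fin.sum_univ_add] at e
    have h5 := col_le (W - Wh) (Fin.castAdd m j)
    have h6 := pow_le_pow_left₀ (norm_nonneg _) hpert 2
    have : 0 ≤ ∑ i : Fin k, D (Fin.castAdd m j) (Fin.castAdd m i) ^ 2 := Finset.sum_nonneg fun _ _ => sq_nonneg _
    have h7 : ∀ i : Fin m, D (Fin.castAdd m j) (Fin.natAdd k i) = B (Fin.castAdd m j) (Fin.natAdd k i) := by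
      intro i
      have hne : Fin.castAdd m j ≠ Fin.natAdd k i := by
        intro h
        have := congrArg Fin.val h
        simp at this
        omega
      rw [hDB, Matrix.sub_apply, Matrix.one_apply_ne hne, sub_zero]
    simp only [h7, Matrix.transpose_apply] at e
    linarith
  simp_rw [h1]
  rw [Finset.sum_comm, Fin.sum_univ_add]
  simp_rw [← Finset.mul_sum]
  set S1 := ∑ j : Fin k, Λ (Fin.castAdd m j) with hS1
  set S2 := ∑ j : Fin m, Λ (Fin.natAdd k j) with hS2
  have hS1n : 0 ≤ S1 := Finset.sum_nonneg fun _ _ => hΛnonneg _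
  have hS2n : 0 ≤ S2 := Finset.sum_nonneg fun _ _ => hΛnonneg _
  have a1 : ∑ j : Fin k, Λ (Fin.castAdd m j) * ∑ i : Fin m, B (Fin.castAdd m j) (Fin.natAdd k i) ^ 2 ≤ S1 * ε ^ 2 := by
    rw [hS1, Finset.sum_mul]
    exact Finset.sum_le_sum fun j _ => mul_le_mul_of_nonneg_left (h3 j) (hΛnonneg _)
  have a2 : ∑ j : Fin m, Λ (Fin.natAdd k j) * ∑ i : Fin m, B (Fin.natAdd k j) (Fin.natAdd k i) ^ 2 ≤ S2 := by
    rw [hS2]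
    exact Finset.sum_le_sum fun j _ => mul_le_of_le_one_right (hΛnonneg _) (h2 j)
  have b1 := Real.sq_sqrt hS1n
  have b2 := Real.sq_sqrt hS2n
  have b3 : 0 ≤ ε * Real.sqrt S1 * Real.sqrt S2 := by positivity
  calc _ ≤ S1 * ε ^ 2 + S2 := add_le_add a1 a2
    _ = ε ^ 2 * Real.sqrt S1 ^ 2 + Real.sqrt S2 ^ 2 := by rw [b1, b2]; ring
    _ ≤ _ := by nlinarith

lemma exp_half_lip {a b : ℝ} (ha : 0 ≤ a) (hb : 0 ≤ b) :
    (Real.exp (-a / 2) - Real.exp (-b / 2)) ^ 2 ≤ (1 / 4) * (a - b) ^ 2 := by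
  wlog h : a ≤ b generalizing a b
  · have := this hb ha (le_of_not_ge h)
    nlinarith
  have h1 : Real.exp (-b / 2) = Real.exp (-a / 2) * Real.exp (-(b - a) / 2) := by
    rw [← Real.exp_add]; ring_nf
  have h2 := Real.add_one_le_exp (-(b - a) / 2)
  have h3 : Real.exp (-a / 2) ≤ 1 := Real.exp_le_one_iff.2 (by linarith)
  have h4 := Real.exp_pos (-a / 2)
  have h5 : Real.exp (-b / 2) ≤ Real.exp (-a / 2) := Real.exp_le_exp.2 (by linarith)
  have h6 : Real.exp (-a / 2) - Real.exp (-b / 2) ≤ (b - a) / 2 := by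
    rw [h1]; nlinarith
  have := pow_le_pow_left₀ (sub_nonneg.2 h5) h6 2
  nlinarith

lemma hell_abs {α : Type*} [MeasurableSpace α] (μ : Measure α) [IsProbabilityMeasure μ]
    (f F : α → ℝ) (hfm : Measurable f) (hFm : Measurable F) (hf0 : ∀ x, 0 ≤ f x)
    (hF0 : ∀ x, 0 ≤ F x) (hFi : Integrable F μ) (hEq : ∫ x, F x ∂μ = ∫ x, f x ∂μ)
    (hsq : Integrable (fun x => (f x - F x) ^ 2) μ) (K : ℝ) (hK : ∫ x, (f x - F x) ^ 2 ∂μ ≤ K)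
    (Z Zg : ℝ) (hZ : Z = ∫ x, Real.exp (-f x) ∂μ) (hZg : Zg = ∫ x, Real.exp (-F x) ∂μ)
    (L : ℝ) (hL : L ^ 2 = (1 / 8) * (Z * Real.exp (-∫ x, f x ∂μ)) ^ (-(1 / 2 : ℝ))) :
    (1 / 2) * ∫ x, (Real.sqrt (Real.exp (-f x) / Z) - Real.sqrt (Real.exp (-F x) / Zg)) ^ 2 ∂μ ≤
      L ^ 2 * K := by
  have hbd : ∀ g : α → ℝ, Measurable g → (∀ x, 0 ≤ g x) → Integrable (fun x => Real.exp (-g x)) μ := by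
    intro g hg hg0
    refine Integrable.of_bound (by fun_prop) 1 (Filter.Eventually.of_forall fun x => ?_)
    rw [Real.norm_of_nonneg (Real.exp_pos _).le]
    exact Real.exp_le_one_iff.2 (by linarith [hg0 x])
  have hif := hbd f hfm hf0
  have hiF := hbd F hFm hF0
  have huv := hbd (fun x => (f x + F x) / 2) (by fun_prop) (fun x => by linarith [hf0 x, hF0 x])
  have hZpos : 0 < Z := by rw [hZ]; exact integral_exp_pos hif
  have hZgpos : 0 < Zg := by rw [hZg]; exact integral_exp_pos hiF
  set c := ∫ x, f x ∂μ with hc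
  have hJ : Real.exp (-c) ≤ Zg := by
    have : ∫ x, (Real.exp (-c) * (1 + c) - Real.exp (-c) * F x) ∂μ ≤ Zg := by
      rw [hZg]
      apply integral_mono ((integrable_const _).sub (hFi.const_mul _)) hiF
      intro x
      have h1 := Real.add_one_le_exp (-F x + c)
      have h2 : Real.exp (-F x) = Real.exp (-c) * Real.exp (-F x + c) := by
        rw [← Real.exp_add]; ring_nf
      have h3 := Real.exp_pos (-c)
      simp only [h2, Pi.sub_apply]
      nlinarith
    rw [integral_sub (integrable_const _) (hFi.const_mul _), integral_const_mul _ F, hEq] at this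
    simp at this
    linarith
  set I := ∫ x, Real.exp (-((f x + F x) / 2)) ∂μ with hI
  set s := Real.sqrt Z with hs
  set r := Real.sqrt Zg with hr
  have hspos : 0 < s := Real.sqrt_pos.2 hZpos
  have hrpos : 0 < r := Real.sqrt_pos.2 hZgpos
  have hs2 : s ^ 2 = Z := Real.sq_sqrt hZpos.le
  have hr2 : r ^ 2 = Zg := Real.sq_sqrt hZgpos.le
  have hgen : ∀ a b d : ℝ, ∫ x, (a * Real.exp (-f x) + b * Real.exp (-F x) - d * Real.exp (-((f x + F x) / 2))) ∂μ
      = a * Z + b * Zg - d * I := by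
    intro a b d
    have h1 : Integrable (fun x => a * Real.exp (-f x) + b * Real.exp (-F x)) μ :=
      (hif.const_mul _).add (hiF.const_mul _)
    rw [integral_sub h1 (huv.const_mul _), integral_add (hif.const_mul _) (hiF.const_mul _),
      integral_const_mul, integral_const_mul, integral_const_mul, ← hZ, ← hZg]
  have ef : ∀ x, Real.exp (-f x) = Real.exp (-f x / 2) ^ 2 := fun x => by
    rw [← Real.exp_nat_mul]; congr 1; push_cast; ring
  have eF : ∀ x, Real.exp (-F x) = Real.exp (-F x / 2) ^ 2 := fun x => by
    rw [← Real.exp_nat_mul]; congr 1; push_cast; ring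
  have efF : ∀ x, Real.exp (-((f x + F x) / 2)) = Real.exp (-f x / 2) * Real.exp (-F x / 2) := fun x => by
    rw [← Real.exp_add]; congr 1; ring
  have hA : ∫ x, (Real.sqrt (Real.exp (-f x) / Z) - Real.sqrt (Real.exp (-F x) / Zg)) ^ 2 ∂μ =
      2 - 2 * (I / (s * r)) := by
    have : ∀ x, (Real.sqrt (Real.exp (-f x) / Z) - Real.sqrt (Real.exp (-F x) / Zg)) ^ 2 =
        Z⁻¹ * Real.exp (-f x) + Zg⁻¹ * Real.exp (-F x) - (2 / (s * r)) * Real.exp (-((f x + F x) / 2)) := by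
      intro x
      rw [Real.sqrt_div (Real.exp_pos _).le, Real.sqrt_div (Real.exp_pos _).le, ← Real.exp_half,
        ← Real.exp_half, ef, eF, efF, ← hs, ← hr, ← hs2, ← hr2]
      field_simp
      ring
    simp_rw [this]
    rw [hgen]
    field_simp
    ring
  have hB : Z + Zg - 2 * I ≤ (1 / 4) * K := by
    have := hgen 1 1 2
    rw [one_mul, one_mul] at this
    rw [← this]
    calc _ ≤ ∫ x, (1 / 4) * (f x - F x) ^ 2 ∂μ := by
          refine integral_mono (((hif.const_mul _).add (hiF.const_mul _)).sub (huv.const_mul _)) (hsq.const_mul _) fun x => ?_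
          have := exp_half_lip (hf0 x) (hF0 x)
          simp only [ef, eF, efF]
          nlinarith
      _ ≤ _ := by rw [integral_const_mul]; linarith
  have hK0 : 0 ≤ K := (integral_nonneg fun x => sq_nonneg _).trans hK
  have hL2 : (1 / 8) * (1 / (s * r)) ≤ L ^ 2 := by
    rw [hL, Real.rpow_neg (by positivity), ← Real.sqrt_eq_rpow, Real.sqrt_mul hZpos.le, ← hs, one_div (s * r)]
    have : Real.sqrt (Real.exp (-c)) ≤ r := Real.sqrt_le_sqrt hJ
    have h0 : 0 < Real.sqrt (Real.exp (-c)) := Real.sqrt_pos.2 (Real.exp_pos _)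
    gcongr
  rw [hA]
  have h1 : s * r - I ≤ K / 8 := by nlinarith [sq_nonneg (s - r)]
  calc (1 / 2) * (2 - 2 * (I / (s * r))) = (s * r - I) * (1 / (s * r)) := by field_simp
    _ ≤ (K / 8) * (1 / (s * r)) := by gcongr
    _ = ((1 / 8) * (1 / (s * r))) * K := by ring
    _ ≤ _ := mul_le_mul_of_nonneg_right hL2 hK0

lemma pgrad_slice {k m : ℕ} {f : (Fin (k + m) → ℝ) → ℝ} (hf : ContDiff ℝ 1 f)
    (Wh : Matrix (Fin (k + m)) (Fin (k + m)) ℝ) (u : Fin (k + m) → ℝ) (z : Fin m → ℝ) (i : Fin m) :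
    pgrad (fun z => f (u + Wh.submatrix id (Fin.natAdd k) *ᵥ z)) z i =
      ∑ a, Wh a (Fin.natAdd k i) * pgrad f (u + Wh.submatrix id (Fin.natAdd k) *ᵥ z) a := by
  rw [← fderiv_apply_sum]
  have h1 : HasFDerivAt (fun z : Fin m → ℝ => u + Wh.submatrix id (Fin.natAdd k) *ᵥ z)
      (LinearMap.toContinuousLinearMap (Matrix.mulVecLin (Wh.submatrix id (Fin.natAdd k)))) z :=
    (LinearMap.toContinuousLinearMap
      (Matrix.mulVecLin (Wh.submatrix id (Fin.natAdd k)))).hasFDerivAt.const_add u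
  have h2 := ((hf.differentiable one_ne_zero
    (u + Wh.submatrix id (Fin.natAdd k) *ᵥ z)).hasFDerivAt).comp z h1
  have h3 := h2.fderiv
  unfold pgrad
  rw [show (fun z => f (u + Wh.submatrix id (Fin.natAdd k) *ᵥ z)) =
    f ∘ (fun z => u + Wh.submatrix id (Fin.natAdd k) *ᵥ z) from rfl, h3]
  simp only [ContinuousLinearMap.comp_apply]
  congr 1
  ext a
  simp

lemma WhT_slice {k m : ℕ} (Wh : Matrix (Fin (k + m)) (Fin (k + m)) ℝ) (hWh : Whᵀ * Wh = 1)
    (y : Fin k → ℝ) (z : Fin m → ℝ) : (Wh.submatrix id (Fin.castAdd m))ᵀ *ᵥ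
      (Wh.submatrix id (Fin.castAdd m) *ᵥ y + Wh.submatrix id (Fin.natAdd k) *ᵥ z) = y := by
  rw [Matrix.mulVec_add, Matrix.mulVec_mulVec, Matrix.mulVec_mulVec]
  have e1 : (Wh.submatrix id (Fin.castAdd m))ᵀ * Wh.submatrix id (Fin.castAdd m) = 1 := by
    ext i j
    have := congrFun (congrFun hWh (Fin.castAdd m i)) (Fin.castAdd m j)
    simpa [Matrix.mul_apply, Matrix.one_apply] using this
  have e2 : (Wh.submatrix id (Fin.castAdd m))ᵀ * Wh.submatrix id (Fin.natAdd k) = 0 := by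
    ext i j
    have := congrFun (congrFun hWh (Fin.castAdd m i)) (Fin.natAdd k j)
    have hne : Fin.castAdd m i ≠ Fin.natAdd k j := by
      intro h
      have := congrArg Fin.val h
      simp at this
      omega
    rw [Matrix.one_apply_ne hne] at this
    simpa [Matrix.mul_apply] using this
  rw [e1, e2]; simp

/-- Hellinger bound between the true posterior `ρ_post = e^{-f}ρX/Z` and the
approximate posterior `ρ_{post,ĝ} = e^{-f_ĝ}ρX/Z_ĝ` built from the perturbed active subspace:
`d_H(ρ_post, ρ_{post,ĝ}) ≤ L (ε(λ₁+⋯+λ_k)^{1/2} + (λ_{k+1}+⋯+λ_{k+m})^{1/2})` with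
`L² = (1/8)(Z exp(-∫ f ρX dx))^{-1/2}`. -/
theorem hellinger_posterior_perturbed_bound
    (k m : ℕ)
    (f : (Fin (k + m) → ℝ) → ℝ)
    (hf : ContDiff ℝ 1 f)
    (hfnonneg : ∀ x, 0 ≤ f x)
    (hfint : Integrable fun x => f x * gaussDensity (k + m) x)
    (hsq : ∀ i, Integrable fun x => (pgrad f x i) ^ 2 * gaussDensity (k + m) x)
    (W : Matrix (Fin (k + m)) (Fin (k + m)) ℝ)
    (hW : Wᵀ * W = 1)
    (Λ : Fin (k + m) → ℝ)
    (hΛdesc : ∀ i j, i ≤ j → Λ j ≤ Λ i)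
    (hΛnonneg : ∀ i, 0 ≤ Λ i)
    (hC : (Matrix.of fun i j => ∫ x, pgrad f x i * pgrad f x j * gaussDensity (k + m) x) =
      W * Matrix.diagonal Λ * Wᵀ)
    (Wh : Matrix (Fin (k + m)) (Fin (k + m)) ℝ)
    (hWh : Whᵀ * Wh = 1)
    (ε : ℝ) (hε : 0 < ε)
    (hpert : ‖W - Wh‖ ≤ ε)
    (gh : (Fin k → ℝ) → ℝ)
    (hgh : ∀ y, gh y = ∫ z, f (Wh.submatrix id (Fin.castAdd m) *ᵥ y +
      Wh.submatrix id (Fin.natAdd k) *ᵥ z) * gaussDensity m z)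
    (Z Zgh : ℝ)
    (hZ : Z = ∫ x, Real.exp (-f x) * gaussDensity (k + m) x)
    (hZgh : Zgh = ∫ x, Real.exp (-gh ((Wh.submatrix id (Fin.castAdd m))ᵀ *ᵥ x)) *
      gaussDensity (k + m) x)
    (L : ℝ) (hLpos : 0 < L)
    (hL : L ^ 2 = (1 / 8) *
      (Z * Real.exp (-∫ x, f x * gaussDensity (k + m) x)) ^ (-(1 / 2 : ℝ))) :
    hellingerDist (fun x => Real.exp (-f x) * gaussDensity (k + m) x / Z)
        (fun x => Real.exp (-gh ((Wh.submatrix id (Fin.castAdd m))ᵀ *ᵥ x)) *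
          gaussDensity (k + m) x / Zgh) ≤
      L * (ε * Real.sqrt (∑ j : Fin k, Λ (Fin.castAdd m j)) +
        Real.sqrt (∑ j : Fin m, Λ (Fin.natAdd k j))) := by
  have hfc := hf.continuous
  have hpc := fun i => pgrad_cont hf i
  have hTmp := T_mp k m Wh hWh
  set T : (Fin k → ℝ) × (Fin m → ℝ) → (Fin (k + m) → ℝ) := fun p =>
    Wh.submatrix id (Fin.castAdd m) *ᵥ p.1 + Wh.submatrix id (Fin.natAdd k) *ᵥ p.2 with hT
  have hTc : Continuous T := by simp only [hT]; fun_prop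
  set F : (Fin (k + m) → ℝ) → ℝ := fun x => gh ((Wh.submatrix id (Fin.castAdd m))ᵀ *ᵥ x) with hF
  have hFT : ∀ p, F (T p) = gh p.1 := fun p => by
    simp only [hF, hT]; rw [WhT_slice Wh hWh]
  have hfi : Integrable f (gam (k + m)) := (gam_integrable _ _).2 hfint
  have hfTi : Integrable (fun p => f (T p)) ((gam k).prod (gam m)) :=
    hTmp.integrable_comp_of_integrable hfi
  have hgh' : ∀ y, gh y = ∫ z, f (T (y, z)) ∂(gam m) := fun y => by
    rw [hgh, gam_integral]
  have hghm : Measurable gh := by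
    have h1 : StronglyMeasurable (fun y => ∫ z, f (T (y, z)) ∂(gam m)) :=
      StronglyMeasurable.integral_prod_right (f := fun y z => f (T (y, z)))
        (hfc.comp hTc).stronglyMeasurable
    rw [← show gh = (fun y => ∫ z, f (T (y, z)) ∂(gam m)) from funext hgh'] at h1
    exact h1.measurable
  have hFm : Measurable F := hghm.comp (by fun_prop)
  have hgh0 : ∀ y, 0 ≤ gh y := fun y => by
    rw [hgh']; exact integral_nonneg fun z => hfnonneg _
  have hghi : Integrable gh (gam k) := by
    rw [show gh = (fun y => ∫ z, f (T (y, z)) ∂(gam m)) from funext hgh']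
    exact hfTi.integral_prod_left
  have hFTi : Integrable (fun p => F (T p)) ((gam k).prod (gam m)) := by
    simp only [hFT]
    exact hghi.comp_fst _
  have hFi : Integrable F (gam (k + m)) :=
    (hTmp.integrable_comp hFm.aestronglyMeasurable).1 hFTi
  have hEq : ∫ x, F x ∂(gam (k + m)) = ∫ x, f x ∂(gam (k + m)) := by
    rw [← hTmp.map_eq, integral_map hTmp.aemeasurable hFm.aestronglyMeasurable,
      integral_map hTmp.aemeasurable hfc.aestronglyMeasurable, integral_prod _ hfTi,
      integral_prod _ hFTi]
    simp only [hFT, ← hgh']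
    simp
  -- gradient part
  set C : Matrix (Fin (k + m)) (Fin (k + m)) ℝ :=
    Matrix.of fun i j => ∫ x, pgrad f x i * pgrad f x j * gaussDensity (k + m) x with hCdef
  set K := ∑ i : Fin m, ∑ a, ∑ b, Wh a (Fin.natAdd k i) * Wh b (Fin.natAdd k i) * C a b with hK
  have htr := trace_bound k m W Wh C hW hWh Λ hΛnonneg hC ε hε hpert
  have hL2 : ∀ i, MemLp (fun x => pgrad f x i) 2 (gam (k + m)) := fun i =>
    (memLp_two_iff_integrable_sq (hpc i).aestronglyMeasurable).2 ((gam_integrable _ _).2 (hsq i))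
  let Gr : (Fin (k + m) → ℝ) → ℝ := fun x =>
    ∑ i : Fin m, (∑ a, Wh a (Fin.natAdd k i) * pgrad f x a) ^ 2
  have hGrc : Continuous Gr := by simp only [Gr]; fun_prop
  have hGr : ∀ x, Gr x = ∑ i : Fin m, ∑ a, ∑ b, Wh a (Fin.natAdd k i) * Wh b (Fin.natAdd k i) *
      (pgrad f x a * pgrad f x b) := by
    intro x
    simp only [Gr]
    refine Finset.sum_congr rfl fun i _ => ?_
    rw [sq, Finset.sum_mul_sum]
    refine Finset.sum_congr rfl fun a _ => Finset.sum_congr rfl fun b _ => ?_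
    ring
  have hab : ∀ a b, Integrable (fun x => pgrad f x a * pgrad f x b) (gam (k + m)) := fun a b =>
    (hL2 a).integrable_mul (hL2 b)
  have hGri : Integrable Gr (gam (k + m)) := by
    rw [show Gr = _ from funext hGr]
    exact integrable_finsetSum _ fun i _ => integrable_finsetSum _ fun a _ =>
      integrable_finsetSum _ fun b _ => (hab a b).const_mul _
  have hGrK : ∫ x, Gr x ∂(gam (k + m)) = K := by
    simp_rw [hGr]
    rw [hK, integral_finsetSum _ fun i _ => integrable_finsetSum _ fun a _ =>
      integrable_finsetSum _ fun b _ => (hab a b).const_mul _]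
    refine Finset.sum_congr rfl fun i _ => ?_
    rw [integral_finsetSum _ fun a _ =>
      integrable_finsetSum _ fun b _ => (hab a b).const_mul _]
    refine Finset.sum_congr rfl fun a _ => ?_
    rw [integral_finsetSum _ fun b _ => (hab a b).const_mul _]
    refine Finset.sum_congr rfl fun b _ => ?_
    rw [integral_const_mul, gam_integral]
    rfl
  have hdm : Measurable (fun x => (f x - F x) ^ 2) := (hfc.measurable.sub hFm).pow_const 2
  have hlin : ∫⁻ x, ENNReal.ofReal ((f x - F x) ^ 2) ∂(gam (k + m)) ≤ ENNReal.ofReal K := by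
    rw [← hGrK, ofReal_integral_eq_lintegral_ofReal hGri
      (Filter.Eventually.of_forall fun x => Finset.sum_nonneg fun _ _ => sq_nonneg _)]
    have m1 : Measurable (fun p => ENNReal.ofReal ((f (T p) - F (T p)) ^ 2)) :=
      hdm.ennreal_ofReal.comp hTmp.measurable
    have m2 : Measurable (fun p => ENNReal.ofReal (Gr (T p))) :=
      hGrc.measurable.ennreal_ofReal.comp hTmp.measurable
    rw [← hTmp.lintegral_comp hdm.ennreal_ofReal,
      ← hTmp.lintegral_comp hGrc.measurable.ennreal_ofReal,
      lintegral_prod _ m1.aemeasurable,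
      lintegral_prod _ m2.aemeasurable]
    apply lintegral_mono_ae
    filter_upwards [hfTi.prod_right_ae] with y hy
    have hp := poincare (h := fun z => f (T (y, z))) (hf.comp (by
      simp only [hT]
      exact contDiff_const.add (LinearMap.toContinuousLinearMap
        (Matrix.mulVecLin (Wh.submatrix id (Fin.natAdd k)))).contDiff)) hy
    rw [← hgh'] at hp
    simp only [hFT]
    refine hp.trans (le_of_eq ?_)
    congr 1
    ext z
    simp only [Gr, hT]
    simp only [pgrad_slice hf]
  have hsqi : Integrable (fun x => (f x - F x) ^ 2) (gam (k + m)) := by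
    refine ⟨hdm.aestronglyMeasurable, ?_⟩
    rw [hasFiniteIntegral_iff_ofReal (Filter.Eventually.of_forall fun x => sq_nonneg _)]
    exact hlin.trans_lt ENNReal.ofReal_lt_top
  have hK0 : 0 ≤ K := by
    rw [← hGrK]; exact integral_nonneg fun x => Finset.sum_nonneg fun _ _ => sq_nonneg _
  have hsqK : ∫ x, (f x - F x) ^ 2 ∂(gam (k + m)) ≤ K := by
    rw [← ofReal_integral_eq_lintegral_ofReal hsqi
      (Filter.Eventually.of_forall fun x => sq_nonneg _)] at hlin
    exact (ENNReal.ofReal_le_ofReal_iff hK0).1 hlin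
  rw [← gam_integral] at hZ hZgh hL
  have hfinal := hell_abs (gam (k + m)) f F hfc.measurable hFm hfnonneg (fun x => hgh0 _) hFi hEq
    hsqi K hsqK Z Zgh hZ hZgh L hL
  unfold hellingerDist
  apply Real.sqrt_le_iff.2
  refine ⟨by positivity, ?_⟩
  have hconv : ∫ x, (Real.sqrt (Real.exp (-f x) * gaussDensity (k + m) x / Z) -
      Real.sqrt (Real.exp (-F x) * gaussDensity (k + m) x / Zgh)) ^ 2 =
      ∫ x, (Real.sqrt (Real.exp (-f x) / Z) - Real.sqrt (Real.exp (-F x) / Zgh)) ^ 2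
        ∂(gam (k + m)) := by
    rw [gam_integral]
    congr 1
    ext x
    have hg := (gaussDensity_pos (k + m) x).le
    rw [mul_div_right_comm, mul_div_right_comm, Real.sqrt_mul' _ hg, Real.sqrt_mul' _ hg,
      ← sub_mul, mul_pow, Real.sq_sqrt hg]
  rw [hconv, mul_pow]
  exact hfinal.trans (mul_le_mul_of_nonneg_left htr (sq_nonneg L))
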